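/- (Strict equivalence as boxed biconditional) For all modal formulas φ, ψ, the formula (φ≡ψ) ↔ □(φ↔ψ) is a theorem of S1+SP. -/

import Mathlib

/-- Modal formulas over countably many propositional variables x₀, x₁, …. -/
inductive Fm : Type
  | var : ℕ → Fm
  | neg : Fm → Fm
  | imp : Fm → Fm → Fm
  | box : Fm → Fm
deriving DecidableEq

namespace Fm

/-- ⊤ := x₀ → x₀ -/
def top : Fm := imp (var 0) (var 0)

/-- φ ∧ ψ := ¬(φ → ¬ψ) -/
def conj (φ ψ : Fm) : Fm := neg (imp φ (neg ψ))

/-- φ ↔ ψ := (φ → ψ) ∧ (ψ → φ) -/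
def biimp (φ ψ : Fm) : Fm := conj (imp φ ψ) (imp ψ φ)

/-- strict equivalence: φ ≡ ψ := □(φ → ψ) ∧ □(ψ → φ) -/
def equiv (φ ψ : Fm) : Fm := conj (box (imp φ ψ)) (box (imp ψ φ))

/-- φ[x := ψ]: substitution of ψ for all occurrences of the variable x in φ. -/
def subst (φ : Fm) (x : ℕ) (ψ : Fm) : Fm :=
  match φ with
  | var y => if y = x then ψ else var y
  | neg χ => neg (subst χ x ψ)
  | imp χ δ => imp (subst χ x ψ) (subst δ x ψ)
  | box χ => box (subst χ x ψ)

/-- Propositional (two-valued) evaluation of a modal formula, treating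
variables and boxed formulas as atoms. -/
def pEval (v : Fm → Bool) : Fm → Bool
  | var n => v (var n)
  | neg φ => !(pEval v φ)
  | imp φ ψ => !(pEval v φ) || pEval v ψ
  | box φ => v (box φ)

/-- φ has the form of a propositional tautology, i.e. φ is a substitution
instance of a propositional tautology. -/
def isTautInstance (φ : Fm) : Prop := ∀ v : Fm → Bool, pEval v φ = true

/-- The axioms (i)–(iii) of Lewis system S1 (Lemmon-style). -/
inductive S1Axiom : Fm → Prop
  | taut {φ} : isTautInstance φ → S1Axiom φ
  | ax2 (φ) : S1Axiom (imp (box φ) φ)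
  | ax3 (φ ψ χ) :
      S1Axiom (imp (conj (box (imp φ ψ)) (box (imp ψ χ))) (box (imp φ χ)))

/-- The identity axioms (iv)–(vi), i.e. the Substitution Principle SP. -/
inductive SPAxiom : Fm → Prop
  | ax4 (φ ψ) : SPAxiom (imp (equiv φ ψ) (equiv (neg φ) (neg ψ)))
  | ax5 (φ ψ φ' ψ') :
      SPAxiom (imp (conj (equiv φ ψ) (equiv φ' ψ'))
        (equiv (imp φ φ') (imp ψ ψ')))
  | ax6 (φ ψ) : SPAxiom (imp (equiv φ ψ) (equiv (box φ) (box ψ)))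

/-- Derivability in S1+SP from a set Φ of premises: axioms (i)–(vi),
modus ponens, and Axiom Necessitation AN restricted to axioms (i)–(iii). -/
inductive S1SP : Set Fm → Fm → Prop
  | prem {Φ φ} : φ ∈ Φ → S1SP Φ φ
  | axm {Φ φ} : S1Axiom φ → S1SP Φ φ
  | spAxm {Φ φ} : SPAxiom φ → S1SP Φ φ
  | mp {Φ φ ψ} : S1SP Φ (imp φ ψ) → S1SP Φ φ → S1SP Φ ψ
  | an {Φ φ} : S1Axiom φ → S1SP Φ (box φ)

end Fm

namespace Fm

theorem ded_aux {Φ : Set Fm} {X φ : Fm} (h : S1SP Φ φ) (hΦ : Φ = {X}) : S1SP ∅ (imp X φ) := by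
  have w : ∀ {χ : Fm}, S1SP ∅ χ → S1SP ∅ (imp X χ) := fun {χ} hχ =>
    S1SP.mp (S1SP.axm (S1Axiom.taut (by
      intro v; simp only [pEval]; cases pEval v X <;> cases pEval v χ <;> rfl))) hχ
  induction h with
  | prem hm =>
    subst hΦ
    rw [Set.mem_singleton_iff] at hm
    subst hm
    exact S1SP.axm (S1Axiom.taut (by intro v; simp [pEval]))
  | axm h => exact w (.axm h)
  | spAxm h => exact w (.spAxm h)
  | an h => exact w (.an h)
  | @mp a b _ _ ih1 ih2 =>
    refine S1SP.mp (S1SP.mp (S1SP.axm (S1Axiom.taut ?_)) ih1) ih2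
    intro v; simp only [pEval]
    cases pEval v X <;> cases pEval v a <;> cases pEval v b <;> rfl

section
variable {Φ : Set Fm} {a b c d : Fm}

theorem cI (h1 : S1SP Φ a) (h2 : S1SP Φ b) : S1SP Φ (conj a b) := by
  refine S1SP.mp (S1SP.mp (S1SP.axm (S1Axiom.taut ?_)) h1) h2
  intro v; simp only [pEval, conj]
  cases pEval v a <;> cases pEval v b <;> rfl

theorem cL (h : S1SP Φ (conj a b)) : S1SP Φ a := by
  refine S1SP.mp (S1SP.axm (S1Axiom.taut ?_)) h
  intro v; simp only [pEval, conj]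
  cases pEval v a <;> cases pEval v b <;> rfl

theorem cR (h : S1SP Φ (conj a b)) : S1SP Φ b := by
  refine S1SP.mp (S1SP.axm (S1Axiom.taut ?_)) h
  intro v; simp only [pEval, conj]
  cases pEval v a <;> cases pEval v b <;> rfl

theorem eqBox (h : S1SP Φ (equiv a b)) (ha : S1SP Φ (box a)) : S1SP Φ (box b) :=
  S1SP.mp (S1SP.mp (S1SP.axm (S1Axiom.ax2 _)) (cL (S1SP.mp (S1SP.spAxm (SPAxiom.ax6 a b)) h))) ha

theorem eqSymm (h : S1SP Φ (equiv a b)) : S1SP Φ (equiv b a) := cI (cR h) (cL h)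

theorem eqRefl (a : Fm) : S1SP Φ (equiv a a) := by
  have : S1SP Φ (box (imp a a)) := S1SP.an (S1Axiom.taut (by intro v; simp [pEval]))
  exact cI this this

theorem eqTop (a : Fm) : S1SP Φ (equiv a (imp top a)) := by
  refine cI (S1SP.an (S1Axiom.taut ?_)) (S1SP.an (S1Axiom.taut ?_)) <;>
  · intro v; simp only [pEval, top]
    cases pEval v a <;> cases v (var 0) <;> rfl

theorem boxK (ha : S1SP Φ (box a)) (h : S1SP Φ (box (imp a b))) : S1SP Φ (box b) :=
  eqBox (eqSymm (eqTop b)) (S1SP.mp (S1SP.axm (S1Axiom.ax3 top a b)) (cI (eqBox (eqTop a) ha) h))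

theorem eqNeg (h : S1SP Φ (equiv a b)) : S1SP Φ (equiv (neg a) (neg b)) :=
  S1SP.mp (S1SP.spAxm (SPAxiom.ax4 a b)) h

theorem eqImp (h : S1SP Φ (equiv a b)) (h' : S1SP Φ (equiv c d)) :
    S1SP Φ (equiv (imp a c) (imp b d)) :=
  S1SP.mp (S1SP.spAxm (SPAxiom.ax5 a b c d)) (cI h h')

end

end Fm

open Fm in
/-- Strict equivalence coincides with the boxed biconditional in S1+SP:
(φ ≡ ψ) ↔ □(φ ↔ ψ) is a theorem. -/
theorem strict_equiv_boxed_biimp (φ ψ : Fm) :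
    S1SP ∅ (biimp (equiv φ ψ) (box (biimp φ ψ))) := by
  refine cI (ded_aux ?_ rfl) (ded_aux ?_ rfl)
  · have h : S1SP {equiv φ ψ} (equiv φ ψ) := S1SP.prem rfl
    have h2 : S1SP {equiv φ ψ} (equiv (biimp φ φ) (biimp φ ψ)) :=
      eqNeg (eqImp (eqImp (eqRefl φ) h) (eqNeg (eqImp h (eqRefl φ))))
    refine eqBox h2 (S1SP.an (S1Axiom.taut ?_))
    intro v; simp only [pEval, biimp, conj]
    cases pEval v φ <;> rfl
  · have h : S1SP {box (biimp φ ψ)} (box (biimp φ ψ)) := S1SP.prem rfl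
    refine cI (boxK h (S1SP.an (S1Axiom.taut ?_))) (boxK h (S1SP.an (S1Axiom.taut ?_))) <;>
    · intro v; simp only [pEval, biimp, conj]
      cases pEval v φ <;> cases pEval v ψ <;> rfl
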